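/- Let q and α be real numbers with 0 < q < 1 and α > 0. Then there exists a constant C > 0 (depending only on q and α) such that for every L ≥ 0, every L-Lipschitz function f : ℝ → ℝ, every positive integer n, and every x ∈ ℝ: |A_n(f; x) − f(x)| ≤ C·L/n. -/

import Mathlib

/-- The generalized hyperbolic tangent activation function. -/
noncomputable def h (q α x : ℝ) : ℝ :=
  (Real.exp (α * x) - q * Real.exp (-(α * x))) /
    ((1 + q) * Real.exp (α * x) + (1 - q) * Real.exp (-(α * x)))

/-- The associated density function. -/
noncomputable def ψ (q α x : ℝ) : ℝ :=
  ((1 - q ^ 2) / (2 * (1 + q ^ 2))) * (h q α (x + 1) - h q α (x - 1))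

/-- The quasi-interpolation neural network operator. -/
noncomputable def A (q α : ℝ) (n : ℕ) (f : ℝ → ℝ) (x : ℝ) : ℝ :=
  ∑' k : ℤ, f (k / n) * ψ q α (n * x - k)

/-- The Kantorovich-type neural network operator. -/
noncomputable def K (q α : ℝ) (n : ℕ) (f : ℝ → ℝ) (x : ℝ) : ℝ :=
  ∑' k : ℤ, ((n : ℝ) * ∫ t in ((k : ℝ) / n)..(((k : ℝ) + 1) / n), f t) * ψ q α (n * x - k)

open Filter Topology

/-- The rescaling of `h q α` to a sigmoid with limits `0` and `1`. -/
noncomputable def shiftedSigmoid (r α x : ℝ) : ℝ :=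
  1 / (1 + r * Real.exp (-(2 * α * x)))

lemma shiftedSigmoid_pos {r : ℝ} (hr : 0 < r) (α x : ℝ) : 0 < shiftedSigmoid r α x := by
  unfold shiftedSigmoid; positivity

lemma shiftedSigmoid_lt_one {r : ℝ} (hr : 0 < r) (α x : ℝ) : shiftedSigmoid r α x < 1 := by
  unfold shiftedSigmoid
  have : 0 < r * Real.exp (-(2 * α * x)) := by positivity
  rw [div_lt_one (by positivity)]
  linarith

lemma shiftedSigmoid_monotone {r α : ℝ} (hr : 0 < r) (hα : 0 < α) :
    Monotone (shiftedSigmoid r α) := by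
  intro x y hxy
  unfold shiftedSigmoid
  gcongr

lemma shiftedSigmoid_le_exp {r : ℝ} (hr : 0 < r) (α x : ℝ) :
    shiftedSigmoid r α x ≤ r⁻¹ * Real.exp (2 * α * x) := by
  unfold shiftedSigmoid
  calc 1 / (1 + r * Real.exp (-(2 * α * x))) ≤ 1 / (r * Real.exp (-(2 * α * x))) := by
        gcongr; linarith
    _ = r⁻¹ * Real.exp (2 * α * x) := by
        rw [Real.exp_neg]; field_simp

lemma one_sub_shiftedSigmoid_le_exp {r : ℝ} (hr : 0 < r) (α x : ℝ) :
    1 - shiftedSigmoid r α x ≤ r * Real.exp (-(2 * α * x)) := by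
  unfold shiftedSigmoid
  have ht : 0 < r * Real.exp (-(2 * α * x)) := by positivity
  rw [sub_le_iff_le_add, ← sub_le_iff_le_add', le_div_iff₀ (by positivity)]
  nlinarith

lemma tendsto_shiftedSigmoid_atTop {r α : ℝ} (hα : 0 < α) :
    Tendsto (shiftedSigmoid r α) atTop (𝓝 1) := by
  have h1 : Tendsto (fun x : ℝ => Real.exp (-(2 * α * x))) atTop (𝓝 0) :=
    Real.tendsto_exp_neg_atTop_nhds_zero.comp (tendsto_id.const_mul_atTop (by positivity))
  have h2 := ((h1.const_mul r).const_add 1)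
  unfold shiftedSigmoid
  simpa using h2.inv₀ (by simp)

lemma tendsto_shiftedSigmoid_atBot {r α : ℝ} (hr : 0 < r) (hα : 0 < α) :
    Tendsto (shiftedSigmoid r α) atBot (𝓝 0) := by
  have h1 : Tendsto (fun x : ℝ => r⁻¹ * Real.exp (2 * α * x)) atBot (𝓝 0) := by
    simpa using (Real.tendsto_exp_atBot.comp
      (tendsto_id.const_mul_atBot (by positivity : 0 < 2 * α))).const_mul r⁻¹
  exact squeeze_zero (fun x => (shiftedSigmoid_pos hr α x).le)
    (fun x => shiftedSigmoid_le_exp hr α x) h1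

lemma ψ_eq_shiftedSigmoid {q : ℝ} (hq0 : 0 < q) (hq1 : q < 1) (α x : ℝ) :
    ψ q α x = (shiftedSigmoid ((1 - q) / (1 + q)) α (x + 1)
      - shiftedSigmoid ((1 - q) / (1 + q)) α (x - 1)) / 2 := by
  have hq : 0 < 1 - q := by linarith
  have key : ∀ y, h q α y = -q / (1 - q)
      + ((1 + q ^ 2) / (1 - q ^ 2)) * shiftedSigmoid ((1 - q) / (1 + q)) α y := by
    intro y
    have h2 : Real.exp (-(2 * α * y)) = Real.exp (-(α * y)) / Real.exp (α * y) := by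
      rw [← Real.exp_sub]; congr 1; ring
    have hp := Real.exp_pos (α * y)
    have hn := Real.exp_pos (-(α * y))
    unfold h shiftedSigmoid
    rw [h2]
    generalize Real.exp (α * y) = a at *
    generalize Real.exp (-(α * y)) = b at *
    have h3 : 1 / (1 + (1 - q) / (1 + q) * (b / a))
        = (1 + q) * a / ((1 + q) * a + (1 - q) * b) := by
      field_simp
    have h4 : 1 - q ^ 2 = (1 - q) * (1 + q) := by ring
    have h5 : 0 < (1 + q) * a + (1 - q) * b := by positivity
    rw [h3, h4]
    field_simp
    ring
  have h4 : 1 - q ^ 2 ≠ 0 := by nlinarith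
  unfold ψ
  rw [key, key]
  field_simp
  ring

lemma ψ_nonneg {q α : ℝ} (hq0 : 0 < q) (hq1 : q < 1) (hα : 0 < α) (x : ℝ) : 0 ≤ ψ q α x := by
  rw [ψ_eq_shiftedSigmoid hq0 hq1]
  have := shiftedSigmoid_monotone (div_pos (sub_pos.2 hq1) (by linarith : 0 < 1 + q)) hα
    (by linarith : x - 1 ≤ x + 1)
  linarith

/-- The density `ψ q α` decays exponentially. -/
lemma exists_ψ_le_exp {q α : ℝ} (hq0 : 0 < q) (hq1 : q < 1) :
    ∃ M : ℝ, 0 < M ∧ ∀ x, ψ q α x ≤ M * Real.exp (-(2 * α * |x|)) := by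
  set r := (1 - q) / (1 + q) with hr_def
  have hr : 0 < r := div_pos (sub_pos.2 hq1) (by linarith)
  refine ⟨(r⁻¹ + r) * Real.exp (2 * α), by positivity, fun x => ?_⟩
  rw [ψ_eq_shiftedSigmoid hq0 hq1, ← hr_def]
  have hp := shiftedSigmoid_pos hr α (x - 1)
  have hl := shiftedSigmoid_lt_one hr α (x + 1)
  have hp' := shiftedSigmoid_pos hr α (x + 1)
  have hl' := shiftedSigmoid_lt_one hr α (x - 1)
  rcases le_total 0 x with hx | hx
  · have hb := one_sub_shiftedSigmoid_le_exp hr α (x - 1)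
    have he : Real.exp (-(2 * α * (x - 1))) = Real.exp (2 * α) * Real.exp (-(2 * α * |x|)) := by
      rw [abs_of_nonneg hx, ← Real.exp_add]; congr 1; ring
    have : 0 < r⁻¹ * (Real.exp (2 * α) * Real.exp (-(2 * α * |x|))) := by positivity
    rw [he] at hb
    linarith
  · have hb := shiftedSigmoid_le_exp hr α (x + 1)
    have he : Real.exp (2 * α * (x + 1)) = Real.exp (2 * α) * Real.exp (-(2 * α * |x|)) := by
      rw [abs_of_nonpos hx, ← Real.exp_add]; congr 1; ring
    have : 0 < r * (Real.exp (2 * α) * Real.exp (-(2 * α * |x|))) := by positivity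
    rw [he] at hb
    linarith

/-- The integer translates of `ψ q α` form a partition of unity. -/
lemma hasSum_ψ {q α : ℝ} (hq0 : 0 < q) (hq1 : q < 1) (hα : 0 < α) (y : ℝ) :
    HasSum (fun k : ℤ => ψ q α (y - k)) 1 := by
  have hr : 0 < (1 - q) / (1 + q) := div_pos (sub_pos.2 hq1) (by linarith)
  set S := shiftedSigmoid ((1 - q) / (1 + q)) α with hS
  set g : ℝ → ℝ := fun t => (S (y - t + 1) + S (y - t)) / 2 with hg
  have hψ : ∀ t, ψ q α (y - t) = g t - g (t + 1) := by
    intro t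
    rw [ψ_eq_shiftedSigmoid hq0 hq1, ← hS]
    simp only [hg]
    rw [show y - (t + 1) + 1 = y - t by ring, show y - (t + 1) = y - t - 1 by ring]
    ring
  have hbot : Tendsto (fun n : ℕ => g n) atTop (𝓝 0) := by
    have h1 : Tendsto (fun n : ℕ => y - (n : ℝ)) atTop atBot :=
      tendsto_atBot_add_const_left _ y (tendsto_neg_atTop_atBot.comp tendsto_natCast_atTop_atTop)
    have hS0 := tendsto_shiftedSigmoid_atBot hr hα
    simpa using ((hS0.comp (tendsto_atBot_add_const_right _ 1 h1)).add (hS0.comp h1)).div_const 2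
  have htop : Tendsto (fun n : ℕ => g (-n)) atTop (𝓝 1) := by
    have h1 : Tendsto (fun n : ℕ => y - (-(n : ℝ))) atTop atTop := by
      simpa using tendsto_atTop_add_const_left _ y tendsto_natCast_atTop_atTop
    have hS1 := tendsto_shiftedSigmoid_atTop (r := (1 - q) / (1 + q)) hα
    simpa [hg, hS] using ((hS1.comp (tendsto_atTop_add_const_right _ 1 h1)).add (hS1.comp h1)).div_const 2
  have hpos : HasSum (fun n : ℕ => ψ q α (y - ((n : ℤ) : ℝ))) (g 0) := by
    rw [hasSum_iff_tendsto_nat_of_nonneg (fun _ => ψ_nonneg hq0 hq1 hα _)]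
    have hsum : ∀ n : ℕ, ∑ i ∈ Finset.range n, ψ q α (y - ((i : ℤ) : ℝ)) = g 0 - g n := by
      intro n
      have := Finset.sum_range_sub' (fun i : ℕ => g i) n
      simpa [hψ] using this
    simp only [hsum]
    simpa using hbot.const_sub (g 0)
  have hneg : HasSum (fun n : ℕ => ψ q α (y - ((-((n : ℤ) + 1) : ℤ) : ℝ))) (1 - g 0) := by
    rw [hasSum_iff_tendsto_nat_of_nonneg (fun _ => ψ_nonneg hq0 hq1 hα _)]
    have hsum : ∀ n : ℕ, ∑ i ∈ Finset.range n, ψ q α (y - ((-((i : ℤ) + 1) : ℤ) : ℝ))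
        = g (-n) - g 0 := by
      intro n
      have := Finset.sum_range_sub (fun i : ℕ => g (-i)) n
      simpa [hψ] using this
    simp only [hsum]
    exact htop.sub_const (g 0)
  simpa using HasSum.of_nat_of_neg_add_one (f := fun k : ℤ => ψ q α (y - k)) hpos hneg

lemma summable_exp_neg_mul_abs_int {α : ℝ} (hα : 0 < α) :
    Summable (fun k : ℤ => Real.exp (-(α * |(k : ℝ)|))) := by
  have h1 : Summable (fun n : ℕ => Real.exp (-(α * n))) := by
    have := Real.summable_exp_nat_mul_iff.2 (neg_lt_zero.2 hα)
    refine this.congr fun n => ?_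
    congr 1; ring
  exact Summable.of_nat_of_neg (by simpa using h1) (by simpa using h1)

/-- A summable bound, uniform in `y` up to translation, for the first absolute moment of `ψ`. -/
lemma exists_abs_mul_ψ_le {q α : ℝ} (hq0 : 0 < q) (hq1 : q < 1) (hα : 0 < α) :
    ∃ B : ℝ, 0 < B ∧ ∀ (y : ℝ) (k : ℤ),
      |y - k| * ψ q α (y - k) ≤ B * Real.exp (-(α * |((k - ⌊y⌋ : ℤ) : ℝ)|)) := by
  obtain ⟨M, hM, hψ⟩ := exists_ψ_le_exp (α := α) hq0 hq1
  refine ⟨M / α * Real.exp α, by positivity, fun y k => ?_⟩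
  set t := |y - k| with ht
  have ht0 : 0 ≤ t := abs_nonneg _
  have hte : t ≤ Real.exp (α * t) / α := by
    rw [le_div_iff₀ hα]
    linarith [Real.add_one_le_exp (α * t)]
  have hd : |((k - ⌊y⌋ : ℤ) : ℝ)| ≤ 1 + t := by
    have h1 := Int.floor_le y
    have h2 := Int.lt_floor_add_one y
    have h3 := abs_le.1 ht.ge
    push_cast
    rw [abs_le]
    constructor <;> linarith
  calc t * ψ q α (y - k)
      ≤ Real.exp (α * t) / α * (M * Real.exp (-(2 * α * t))) := by
        gcongr
        · exact ψ_nonneg hq0 hq1 hα _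
        · exact hψ _
    _ = M / α * Real.exp (-(α * t)) := by
        rw [show -(α * t) = α * t + -(2 * α * t) by ring, Real.exp_add]; ring
    _ ≤ M / α * (Real.exp α * Real.exp (-(α * |((k - ⌊y⌋ : ℤ) : ℝ)|))) := by
        rw [← Real.exp_add]
        gcongr
        nlinarith
    _ = _ := by ring

theorem quasi_interpolation_lipschitz_rate (q α : ℝ) (hq0 : 0 < q) (hq1 : q < 1)
    (hα : 0 < α) :
    ∃ C : ℝ, 0 < C ∧ ∀ L : ℝ, 0 ≤ L → ∀ f : ℝ → ℝ,
      LipschitzWith (Real.toNNReal L) f → ∀ n : ℕ, 0 < n → ∀ x : ℝ,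
        |A q α n f x - f x| ≤ C * L / n := by
  obtain ⟨B, hB, hmoment⟩ := exists_abs_mul_ψ_le hq0 hq1 hα
  have hT := summable_exp_neg_mul_abs_int hα
  set T := ∑' k : ℤ, Real.exp (-(α * |(k : ℝ)|)) with hT_def
  have hTpos : 0 < T := hT.tsum_pos (fun _ => (Real.exp_pos _).le) 0 (Real.exp_pos _)
  refine ⟨B * T, by positivity, fun L hL f hf n hn x => ?_⟩
  have hn' : (0 : ℝ) < n := Nat.cast_pos.2 hn
  have hbound : ∀ k : ℤ, ‖(f (k / n) - f x) * ψ q α (n * x - k)‖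
      ≤ L / n * B * Real.exp (-(α * |((k - ⌊n * x⌋ : ℤ) : ℝ)|)) := by
    intro k
    have hfk : |f (k / n) - f x| ≤ L / n * |n * x - k| := by
      have h1 := hf.dist_le_mul (k / n) x
      rw [Real.dist_eq, Real.dist_eq, Real.coe_toNNReal L hL] at h1
      have h2 : (k : ℝ) / n - x = -((n * x - k) / n) := by field_simp; ring
      rw [h2, abs_neg, abs_div, abs_of_pos hn'] at h1
      calc _ ≤ _ := h1
        _ = _ := by ring
    rw [Real.norm_eq_abs, abs_mul, abs_of_nonneg (ψ_nonneg hq0 hq1 hα _)]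
    calc |f (k / n) - f x| * ψ q α (n * x - k)
        ≤ L / n * |n * x - k| * ψ q α (n * x - k) :=
          mul_le_mul_of_nonneg_right hfk (ψ_nonneg hq0 hq1 hα _)
      _ = L / n * (|n * x - k| * ψ q α (n * x - k)) := by ring
      _ ≤ L / n * (B * Real.exp (-(α * |((k - ⌊n * x⌋ : ℤ) : ℝ)|))) := by
          exact mul_le_mul_of_nonneg_left (hmoment _ _) (by positivity)
      _ = _ := by ring
  have hsum : HasSum (fun k : ℤ => L / n * B * Real.exp (-(α * |((k - ⌊n * x⌋ : ℤ) : ℝ)|)))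
      (L / n * B * T) :=
    ((Equiv.subRight ⌊n * x⌋).hasSum_iff.2 hT.hasSum).mul_left _
  have hdiff := (Summable.of_norm_bounded hsum.summable hbound).hasSum
  have hA : A q α n f x
      = (∑' k : ℤ, (f (k / n) - f x) * ψ q α (n * x - k)) + f x * 1 := by
    rw [← (hdiff.add ((hasSum_ψ hq0 hq1 hα (n * x)).mul_left (f x))).tsum_eq]
    unfold A
    congr 1
    ext k
    ring
  rw [hA, mul_one, add_sub_cancel_right, ← Real.norm_eq_abs]
  calc _ ≤ L / n * B * T := tsum_of_norm_bounded hsum hbound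
    _ = B * T * L / n := by ring
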